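/- arXiv:2501.18787 — 2 statements merged into one kernel-verified Lean document; each statement's English description precedes it below -/
import Mathlib

section
/- (Positivity of the Morawetz quadratic form.) Let p ∈ ℕ and φ₁, …, φ_p ∈ C_c^∞(ℝ³;ℂ). Define ρ(x) := Σᵢ |φᵢ(x)|², the momentum density J(x) ∈ ℝ³ with components J_k(x) := Σᵢ Im(conj(φᵢ(x)) ∂_k φᵢ(x)), and the stress tensor σ(x) with entries σ_{jk}(x) := Σᵢ Re(conj(∂_j φᵢ(x)) ∂_k φᵢ(x)). Let A : ℝ³ × ℝ³ → Sym₃(ℝ) be a bounded measurable family of real symmetric 3×3 matrices such that A(x,y) is positive semidefinite for every (x,y). Then ∫∫_{ℝ³×ℝ³} [ ⟨A(x,y), σ(x)⟩ ρ(y) + ⟨A(x,y), σ(y)⟩ ρ(x) − 2 J(x)ᵀ A(x,y) J(y) ] dx dy ≥ 0, where ⟨A, σ⟩ := Σ_{j,k} A_{jk} σ_{jk}. -/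
open MeasureTheory Filter Metric Real Topology Function
open scoped ENNReal

noncomputable section

abbrev R3 : Type := EuclideanSpace ℝ (Fin 3)

/-- The `i`-th standard coordinate vector of `ℝ³`. -/
def e3 (i : Fin 3) : R3 := EuclideanSpace.single i 1

/-- Mass density `ρ(x) = Σᵢ |φᵢ(x)|²`. -/
def massDensity {p : ℕ} (φ : Fin p → R3 → ℂ) (x : R3) : ℝ :=
  ∑ i, ‖φ i x‖ ^ 2

/-- Momentum density `J_k(x) = Σᵢ Im(conj(φᵢ(x)) ∂_k φᵢ(x))`. -/
def momDensity {p : ℕ} (φ : Fin p → R3 → ℂ) (x : R3) (k : Fin 3) : ℝ :=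
  ∑ i, ((starRingEnd ℂ) (φ i x) * fderiv ℝ (φ i) x (e3 k)).im

/-- Stress tensor `σ_{jk}(x) = Σᵢ Re(conj(∂_j φᵢ(x)) ∂_k φᵢ(x))`. -/
def stressTensor {p : ℕ} (φ : Fin p → R3 → ℂ) (x : R3) (j k : Fin 3) : ℝ :=
  ∑ i, ((starRingEnd ℂ) (fderiv ℝ (φ i) x (e3 j)) * fderiv ℝ (φ i) x (e3 k)).re

/-- The Hermitian extension of a positive semidefinite real quadratic form is nonnegative. -/
lemma sum_mul_re_conj_mul_nonneg {n : Type*} [Fintype n] {A : Matrix n n ℝ}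
    (hA : A.PosSemidef) (w : n → ℂ) :
    0 ≤ ∑ j, ∑ k, A j k * ((starRingEnd ℂ) (w j) * w k).re := by
  have quad (v : n → ℝ) : 0 ≤ ∑ j, ∑ k, A j k * (v j * v k) := by
    have h := hA.dotProduct_mulVec_nonneg v
    simp only [dotProduct, Matrix.mulVec, Pi.star_apply, star_trivial, Finset.mul_sum] at h
    refine h.trans_eq (Finset.sum_congr rfl fun j _ => Finset.sum_congr rfl fun k _ => ?_)
    ring
  refine (add_nonneg (quad fun j => (w j).re) (quad fun j => (w j).im)).trans_eq ?_
  simp only [← Finset.sum_add_distrib]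
  refine Finset.sum_congr rfl fun j _ => Finset.sum_congr rfl fun k _ => ?_
  simp only [Complex.mul_re, Complex.conj_re, Complex.conj_im]
  ring

/-- The contribution of a single pair of orbitals with values `a`, `b` and gradients `u`, `v`.
Twice the expression is the sum of the squares of `b u - a v` and `conj b u + a conj v`. -/
lemma orbital_pair_nonneg {n : Type*} [Fintype n] {A : Matrix n n ℝ} (hA : A.PosSemidef)
    (hs : A.IsSymm) (a b : ℂ) (u v : n → ℂ) :
    0 ≤ (∑ j, ∑ k, A j k * ((starRingEnd ℂ) (u j) * u k).re) * ‖b‖ ^ 2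
      + (∑ j, ∑ k, A j k * ((starRingEnd ℂ) (v j) * v k).re) * ‖a‖ ^ 2
      - 2 * ∑ j, ∑ k, ((starRingEnd ℂ) a * u j).im * A j k * ((starRingEnd ℂ) b * v k).im := by
  have h₁ := sum_mul_re_conj_mul_nonneg hA (fun j => b * u j - a * v j)
  have h₂ := sum_mul_re_conj_mul_nonneg hA
    (fun j => (starRingEnd ℂ) b * u j + a * (starRingEnd ℂ) (v j))
  have hswap : ∑ j, ∑ k, ((starRingEnd ℂ) a * u j).im * A j k * ((starRingEnd ℂ) b * v k).im
      = ∑ j, ∑ k, ((starRingEnd ℂ) a * u k).im * A j k * ((starRingEnd ℂ) b * v j).im := by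
    rw [Finset.sum_comm]
    exact Finset.sum_congr rfl fun j _ => Finset.sum_congr rfl fun k _ => by rw [hs.apply]
  have key : (∑ j, ∑ k, A j k * ((starRingEnd ℂ) (b * u j - a * v j) * (b * u k - a * v k)).re)
      + (∑ j, ∑ k, A j k * ((starRingEnd ℂ) ((starRingEnd ℂ) b * u j + a * (starRingEnd ℂ) (v j))
          * ((starRingEnd ℂ) b * u k + a * (starRingEnd ℂ) (v k))).re)
      = 2 * ((∑ j, ∑ k, A j k * ((starRingEnd ℂ) (u j) * u k).re) * ‖b‖ ^ 2)
      + 2 * ((∑ j, ∑ k, A j k * ((starRingEnd ℂ) (v j) * v k).re) * ‖a‖ ^ 2)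
      - 2 * (∑ j, ∑ k, ((starRingEnd ℂ) a * u j).im * A j k * ((starRingEnd ℂ) b * v k).im)
      - 2 * ∑ j, ∑ k, ((starRingEnd ℂ) a * u k).im * A j k * ((starRingEnd ℂ) b * v j).im := by
    simp only [Finset.mul_sum, Finset.sum_mul, ← Finset.sum_add_distrib, ← Finset.sum_sub_distrib]
    refine Finset.sum_congr rfl fun j _ => Finset.sum_congr rfl fun k _ => ?_
    simp only [Complex.sq_norm, Complex.normSq_apply, Complex.mul_re, Complex.mul_im,
      Complex.add_re, Complex.add_im, Complex.sub_re, Complex.sub_im, Complex.conj_re,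
      Complex.conj_im]
    ring
  rw [← hswap] at key
  linarith

/-- **Positivity of the Morawetz quadratic form.** -/
theorem morawetz_quadratic_form_nonneg (p : ℕ) (φ : Fin p → R3 → ℂ)
    (hφ : ∀ i, ContDiff ℝ (⊤ : ℕ∞) (φ i) ∧ HasCompactSupport (φ i))
    (A : R3 → R3 → Matrix (Fin 3) (Fin 3) ℝ)
    (hAmeas : ∀ j k : Fin 3, Measurable (fun z : R3 × R3 => A z.1 z.2 j k))
    (hAbdd : ∃ M : ℝ, ∀ (x y : R3) (j k : Fin 3), |A x y j k| ≤ M)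
    (hAsymm : ∀ x y : R3, (A x y).IsSymm)
    (hApsd : ∀ x y : R3, (A x y).PosSemidef) :
    0 ≤ ∫ z : R3 × R3,
        ((∑ j, ∑ k, A z.1 z.2 j k * stressTensor φ z.1 j k) * massDensity φ z.2
          + (∑ j, ∑ k, A z.1 z.2 j k * stressTensor φ z.2 j k) * massDensity φ z.1
          - 2 * ∑ j, ∑ k, momDensity φ z.1 j * A z.1 z.2 j k * momDensity φ z.2 k) := by
  refine integral_nonneg fun z => ?_
  have h := Finset.sum_nonneg fun i (_ : i ∈ Finset.univ) =>
    Finset.sum_nonneg fun m (_ : m ∈ Finset.univ) =>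
      orbital_pair_nonneg (hApsd z.1 z.2) (hAsymm z.1 z.2) (φ i z.1) (φ m z.2)
        (fun j => fderiv ℝ (φ i) z.1 (e3 j)) (fun j => fderiv ℝ (φ m) z.2 (e3 j))
  refine h.trans_eq ?_
  simp only [Finset.sum_sub_distrib, Finset.sum_add_distrib]
  have stress (x : R3) : ∑ j, ∑ k, A z.1 z.2 j k * stressTensor φ x j k
      = ∑ i, ∑ j, ∑ k, A z.1 z.2 j k *
        ((starRingEnd ℂ) (fderiv ℝ (φ i) x (e3 j)) * fderiv ℝ (φ i) x (e3 k)).re := by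
    simp only [stressTensor, Finset.mul_sum, Fin.sum_univ_three, Finset.sum_add_distrib]
  rw [stress, stress, massDensity, massDensity]
  congr 1
  · congr 1
    · rw [Finset.sum_mul_sum]
    · rw [Finset.sum_mul_sum, Finset.sum_comm]
  · simp only [← Finset.mul_sum]
    congr 1
    rw [Finset.sum_comm]
    simp only [momDensity, Fin.sum_univ_three, Finset.sum_add_distrib, Finset.sum_mul,
      Finset.mul_sum]
end
end

section
/- (Hilbert–Schmidt bounds on the pair-excitation kernel.) Let ℓ, b, C₀ > 0 and N ∈ ℕ, and let w : ℝ³ → ℝ be weakly differentiable with 0 ≤ w ≤ 1, supp w ⊆ {|x| ≤ Nℓ}, w(x) ≤ C₀b/|x| and |∇w(x)| ≤ C₀b/|x|² for all x ≠ 0, and ‖∇w‖_{L²(ℝ³)} ≤ C₀. Let u, v ∈ H¹(ℝ³;ℂ) ∩ L^∞(ℝ³;ℂ) and define k(x,y) := −N w(N(x−y)) u(x) v(y). Then there exists a constant C, depending only on ℓ, b, C₀, ‖u‖_{H¹} and ‖v‖_{H¹}, such that ‖k‖_{L²(ℝ³×ℝ³)} ≤ C·min(max(‖u‖_{L^∞},‖v‖_{L^∞}),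 1), and moreover ‖∇_x k‖_{L²(ℝ³×ℝ³)} ≤ C√N·min(‖u‖_{L^∞} + ‖v‖_{L^∞}, 1) and ‖∇_y k‖_{L²(ℝ³×ℝ³)} ≤ C√N·min(‖u‖_{L^∞} + ‖v‖_{L^∞}, 1). -/
open MeasureTheory Filter Metric Real Topology Function
open scoped ENNReal

noncomputable section

/-- The pair-excitation kernel `k(x,y) = −N w(N(x−y)) u(x) v(y)`. -/
def pairKernel (N : ℕ) (w : R3 → ℝ) (u v : R3 → ℂ) (x y : R3) : ℂ :=
  -(N : ℂ) * ((w ((N : ℝ) • (x - y)) : ℝ) : ℂ) * u x * v y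

/-- The `W^{1,r}`-type data of a function: `L^r` norm of the function and its gradient. -/
def W1Norm (r : ℝ≥0∞) (u : R3 → ℂ) : ℝ≥0∞ :=
  eLpNorm u r volume + eLpNorm (fun x => fderiv ℝ u x) r volume

/-- An integrable everywhere differentiable function on the line is bounded by the total
variation given by its derivative. -/
lemma enorm_le_lintegral_enorm_deriv {g : ℝ → ℝ} (hg : Differentiable ℝ g)
    (hint : Integrable g) (a : ℝ) : ‖g a‖ₑ ≤ ∫⁻ t, ‖deriv g t‖ₑ := by
  by_cases hfin : ∫⁻ t, ‖deriv g t‖ₑ = ⊤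
  · simp [hfin]
  have hd : Integrable (deriv g) :=
    ⟨(measurable_deriv g).aestronglyMeasurable, lt_top_iff_ne_top.2 hfin⟩
  have hlim := tendsto_zero_of_hasDerivAt_of_integrableOn_Iic (a := a)
    (fun x _ => (hg x).hasDerivAt) hd.integrableOn hint.integrableOn
  have hftc := integral_Iic_of_hasDerivAt_of_tendsto' (a := a)
    (fun x _ => (hg x).hasDerivAt) hd.integrableOn hlim
  rw [sub_zero] at hftc
  rw [← hftc]
  exact (enorm_integral_le_lintegral_enorm _).trans (setLIntegral_le_lintegral _ _)

/-- Almost every line parallel to a coordinate axis sees an integrable restriction. -/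
lemma ae_integrable_update {n : ℕ} {g : (Fin (n + 1) → ℝ) → ℝ} (hg : Integrable g)
    (i : Fin (n + 1)) : ∀ᵐ x : Fin (n + 1) → ℝ, Integrable fun t => g (update x i t) := by
  have e := volume_preserving_piFinSuccAbove (fun _ : Fin (n + 1) => ℝ) i
  have h1 : Integrable (fun z : ℝ × (Fin n → ℝ) =>
      g ((MeasurableEquiv.piFinSuccAbove (fun _ => ℝ) i).symm z)) :=
    (e.symm.integrable_comp_emb (MeasurableEquiv.measurableEmbedding _)).2 hg
  have h2 : ∀ᵐ y : Fin n → ℝ, Integrable fun t : ℝ => g (i.insertNth t y) :=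
    h1.prod_left_ae
  have h3 : ∀ᵐ z : ℝ × (Fin n → ℝ), Integrable fun t : ℝ => g (i.insertNth t z.2) :=
    Measure.quasiMeasurePreserving_snd.ae h2
  filter_upwards [e.quasiMeasurePreserving.ae h3] with x hx
  convert! hx using 3 with t
  have : update (i.insertNth (x i) (i.removeNth x)) i t = i.insertNth t (i.removeNth x) :=
    Fin.update_insertNth (α := fun _ => ℝ) i (x i) t _
  rwa [Fin.insertNth_self_removeNth] at this

/-- **Gagliardo–Nirenberg–Sobolev inequality** for an integrable function which is merely
everywhere differentiable. -/
lemma lintegral_pow_le_pow_lintegral_fderiv_of_integrable {n : ℕ} {p : ℝ}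
    (hp : Real.HolderConjugate ((n + 1 : ℕ) : ℝ) p) {g : EuclideanSpace ℝ (Fin (n + 1)) → ℝ}
    (hg : Differentiable ℝ g) (hint : Integrable g) :
    ∫⁻ x, ‖g x‖ₑ ^ p ≤ (∫⁻ x, ‖fderiv ℝ g x‖ₑ) ^ p := by
  have hV := PiLp.volume_preserving_toLp (Fin (n + 1))
  have hemb : MeasurableEmbedding (WithLp.toLp 2 : (Fin (n + 1) → ℝ) → _) :=
    (MeasurableEquiv.toLp 2 (Fin (n + 1) → ℝ)).measurableEmbedding
  rw [← hV.lintegral_comp_emb hemb, ← hV.lintegral_comp_emb hemb]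
  have hint' := (hV.integrable_comp_emb hemb).2 hint
  have hn : (1 : ℝ) ≤ n := by
    have := hp.lt
    push_cast at this
    have h0 : (0 : ℝ) < n := by linarith
    exact_mod_cast (Nat.cast_pos.1 h0)
  have hpn : p = (n + 1 : ℝ) * (1 / n) := by
    have := hp.conjugate_eq
    push_cast at this
    rw [this]; simp [div_eq_mul_inv]
  have hmeas : Measurable fun x : Fin (n + 1) → ℝ => ‖fderiv ℝ g (WithLp.toLp 2 x)‖ₑ :=
    ((measurable_fderiv ℝ g).comp hemb.measurable).enorm
  have hgrid := lintegral_prod_lintegral_pow_le (fun _ : Fin (n + 1) => (volume : Measure ℝ))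
    (p := p) (by simpa using hp) hmeas
  refine le_trans (lintegral_mono_ae ?_) hgrid
  filter_upwards [ae_all_iff.2 fun i => ae_integrable_update hint' i] with x hx
  have hle : ∀ i, ‖g (WithLp.toLp 2 x)‖ₑ ≤
      ∫⁻ t, ‖fderiv ℝ g (WithLp.toLp 2 (update x i t))‖ₑ := by
    intro i
    have hline : ∀ t, HasDerivAt (fun t => g (WithLp.toLp 2 (update x i t)))
        (fderiv ℝ g (WithLp.toLp 2 (update x i t)) (EuclideanSpace.single i 1)) t := by
      intro t
      have h1 : HasDerivAt (fun t => WithLp.toLp 2 (update x i t))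
          (EuclideanSpace.single i (1 : ℝ)) t := by
        have := (PiLp.continuousLinearEquiv 2 ℝ (fun _ : Fin (n + 1) => ℝ)).symm.hasFDerivAt
          (x := update x i t) |>.comp_hasDerivAt t (hasDerivAt_update x i t)
        exact this
      exact (hg _).hasFDerivAt.comp_hasDerivAt t h1
    have := enorm_le_lintegral_enorm_deriv (fun t => (hline t).differentiableAt) (hx i) (x i)
    simp only [update_eq_self] at this
    refine this.trans (lintegral_mono fun t => ?_)
    rw [(hline t).deriv]
    refine (ContinuousLinearMap.le_opENorm _ _).trans ?_
    rw [← ofReal_norm (EuclideanSpace.single i (1 : ℝ))]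
    simp
  calc ‖g (WithLp.toLp 2 x)‖ₑ ^ p
      = ∏ _i : Fin (n + 1), ‖g (WithLp.toLp 2 x)‖ₑ ^ (1 / n : ℝ) := by
        rw [Finset.prod_const, ← ENNReal.rpow_natCast, ← ENNReal.rpow_mul, hpn]
        congr 1
        simp [mul_comm]
    _ ≤ _ := by
        simp only [Fintype.card_fin, Nat.cast_add, Nat.cast_one, add_sub_cancel_right]
        gcongr with i
        exact hle i

/-- **Sobolev inequality** `H¹(ℝ³) ⊆ L⁶(ℝ³)` for bounded differentiable functions. -/
lemma lintegral_enorm_pow_six_le {u : R3 → ℂ} (hu : Differentiable ℝ u) {M : ℝ}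
    (hM : ∀ x, ‖u x‖ ≤ M) (hu2 : ∫⁻ x, ‖u x‖ₑ ^ 2 ≠ ⊤) :
    ∫⁻ x, ‖u x‖ₑ ^ 6 ≤ 4096 * (∫⁻ x, ‖fderiv ℝ u x‖ₑ ^ 2) ^ 3 := by
  have hum : Measurable fun x => ‖u x‖ₑ := hu.continuous.measurable.enorm
  have hdm : Measurable fun x => ‖fderiv ℝ u x‖ₑ := (measurable_fderiv ℝ u).enorm
  have hMe : ∀ x, ‖u x‖ₑ ≤ ENNReal.ofReal M := fun x => by
    rw [← ofReal_norm]; exact ENNReal.ofReal_le_ofReal (hM x)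
  have hfin : ∀ k : ℕ, ∫⁻ x, ‖u x‖ₑ ^ (2 + k) ≠ ⊤ := by
    intro k
    refine ne_top_of_le_ne_top (ENNReal.mul_ne_top hu2
      (ENNReal.pow_ne_top (n := k) (ENNReal.ofReal_ne_top (r := M)))) ?_
    rw [← lintegral_mul_const _ (hum.pow_const 2)]
    refine lintegral_mono fun x => ?_
    rw [pow_add]
    gcongr
    exact hMe x
  set g : R3 → ℝ := fun x => (‖u x‖ ^ 2) ^ 2 with hg
  have hgd : ∀ x, HasFDerivAt g _ x := fun x => ((hu x).hasFDerivAt.norm_sq).pow 2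
  have hge : ∀ x, ‖g x‖ₑ = ‖u x‖ₑ ^ 4 := fun x => by
    simp only [hg, enorm_pow, enorm_norm, ← pow_mul]
  have hgdiff : Differentiable ℝ g := fun x => (hgd x).differentiableAt
  have hgint : Integrable g := by
    refine ⟨hgdiff.continuous.aestronglyMeasurable, ?_⟩
    rw [HasFiniteIntegral]
    simp only [hge]
    exact lt_top_iff_ne_top.2 (hfin 2)
  have hgrad : ∀ x, ‖fderiv ℝ g x‖ₑ ≤ 4 * (‖u x‖ₑ ^ 3 * ‖fderiv ℝ u x‖ₑ) := by
    intro x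
    have h : ‖fderiv ℝ g x‖ ≤ 4 * (‖u x‖ ^ 3 * ‖fderiv ℝ u x‖) := by
      refine ContinuousLinearMap.opNorm_le_bound _ (by positivity) fun h => ?_
      rw [(hgd x).fderiv]
      have h1 := abs_real_inner_le_norm (u x) (fderiv ℝ u x h)
      have h2 := (fderiv ℝ u x).le_opNorm h
      simp only [_root_.smul_apply, ContinuousLinearMap.comp_apply,
        innerSL_apply_apply, nsmul_eq_mul, smul_eq_mul, norm_mul, Real.norm_eq_abs,
        Nat.cast_ofNat, abs_pow, abs_norm, abs_two, Nat.add_one_sub_one, pow_one]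
      calc _ ≤ 2 * ‖u x‖ ^ 2 * (2 * (‖u x‖ * (‖fderiv ℝ u x‖ * ‖h‖))) := by
            gcongr
            exact h1.trans (by gcongr)
        _ = _ := by ring
    rw [← ofReal_norm, ← ofReal_norm, ← ofReal_norm]
    refine (ENNReal.ofReal_le_ofReal h).trans_eq ?_
    rw [ENNReal.ofReal_mul (by norm_num), ENNReal.ofReal_mul (by positivity),
      ENNReal.ofReal_pow (by positivity)]
    norm_num
  have hsob := lintegral_pow_le_pow_lintegral_fderiv_of_integrable (n := 2) (p := 3 / 2)
    (by rw [Real.holderConjugate_iff]; norm_num) hgdiff hgint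
  set X := ∫⁻ x, ‖u x‖ₑ ^ 6 with hX
  set D := ∫⁻ x, ‖fderiv ℝ u x‖ₑ ^ 2 with hD
  set J := ∫⁻ x, ‖fderiv ℝ g x‖ₑ with hJ
  have hXJ : X ^ 2 ≤ J ^ 3 := by
    have h1 : X ≤ J ^ (3 / 2 : ℝ) := by
      refine le_trans (le_of_eq (lintegral_congr fun x => ?_)) hsob
      rw [hge, ← ENNReal.rpow_natCast, ← ENNReal.rpow_natCast, ← ENNReal.rpow_mul]
      norm_num
    calc X ^ 2 ≤ (J ^ (3 / 2 : ℝ)) ^ 2 := by gcongr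
      _ = J ^ 3 := by
        rw [← ENNReal.rpow_natCast, ← ENNReal.rpow_natCast, ← ENNReal.rpow_mul]; norm_num
  have hJD : J ^ 2 ≤ 16 * X * D := by
    have h1 : J ≤ 4 * (X ^ (1 / 2 : ℝ) * D ^ (1 / 2 : ℝ)) := by
      calc J ≤ ∫⁻ x, 4 * (‖u x‖ₑ ^ 3 * ‖fderiv ℝ u x‖ₑ) := lintegral_mono hgrad
        _ = 4 * ∫⁻ x, ‖u x‖ₑ ^ 3 * ‖fderiv ℝ u x‖ₑ :=
          lintegral_const_mul _ ((hum.pow_const 3).mul hdm)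
        _ ≤ _ := by
          gcongr
          have := ENNReal.lintegral_mul_le_Lp_mul_Lq volume Real.HolderConjugate.two_two
            (hum.pow_const 3).aemeasurable hdm.aemeasurable
          simpa [← pow_mul] using this
    calc J ^ 2 ≤ (4 * (X ^ (1 / 2 : ℝ) * D ^ (1 / 2 : ℝ))) ^ 2 := by gcongr
      _ = 16 * X * D := by
        rw [mul_pow, mul_pow, ← ENNReal.rpow_natCast (X ^ _), ← ENNReal.rpow_natCast (D ^ _),
          ← ENNReal.rpow_mul, ← ENNReal.rpow_mul]
        norm_num
        ring
  by_cases hX0 : X = 0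
  · simp [hX0]
  have hXt : X ≠ ⊤ := hfin 4
  have key : X ^ 3 * X ≤ X ^ 3 * (4096 * D ^ 3) := by
    calc X ^ 3 * X = (X ^ 2) ^ 2 := by ring
      _ ≤ (J ^ 3) ^ 2 := by gcongr
      _ = (J ^ 2) ^ 3 := by ring
      _ ≤ (16 * X * D) ^ 3 := by gcongr
      _ = _ := by ring
  exact (ENNReal.mul_le_mul_iff_right (pow_ne_zero _ hX0) (ENNReal.pow_ne_top hXt)).1 key

/-- The square of the `L²` norm as a Lebesgue integral. -/
lemma lintegral_enorm_sq_eq_eLpNorm_sq {α E : Type*} [MeasurableSpace α] {μ : Measure α}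
    [NormedAddCommGroup E] (f : α → E) : ∫⁻ x, ‖f x‖ₑ ^ 2 ∂μ = eLpNorm f 2 μ ^ 2 := by
  rw [eLpNorm_eq_lintegral_rpow_enorm_toReal (by norm_num) (by norm_num),
    ← ENNReal.rpow_natCast (_ ^ _), ← ENNReal.rpow_mul]
  simp

/-- The `L⁴` norm of a bounded differentiable function is controlled by its `H¹` norm. -/
lemma lintegral_enorm_pow_four_le {u : R3 → ℂ} (hu : Differentiable ℝ u) {M K : ℝ} (hK : 0 ≤ K)
    (hM : ∀ x, ‖u x‖ ≤ M) (huK : W1Norm 2 u ≤ ENNReal.ofReal K) :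
    ∫⁻ x, ‖u x‖ₑ ^ 4 ≤ ENNReal.ofReal (K ^ 2 + 4096 * K ^ 6) := by
  have h2 : ∫⁻ x, ‖u x‖ₑ ^ 2 ≤ ENNReal.ofReal (K ^ 2) := by
    rw [lintegral_enorm_sq_eq_eLpNorm_sq, ENNReal.ofReal_pow hK]
    gcongr
    exact le_self_add.trans huK
  have hD : ∫⁻ x, ‖fderiv ℝ u x‖ₑ ^ 2 ≤ ENNReal.ofReal (K ^ 2) := by
    rw [lintegral_enorm_sq_eq_eLpNorm_sq, ENNReal.ofReal_pow hK]
    gcongr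
    exact le_add_self.trans huK
  have h6 := lintegral_enorm_pow_six_le hu hM (ne_top_of_le_ne_top ENNReal.ofReal_ne_top h2)
  have hum : Measurable fun x => ‖u x‖ₑ := hu.continuous.measurable.enorm
  calc ∫⁻ x, ‖u x‖ₑ ^ 4 ≤ ∫⁻ x, (‖u x‖ₑ ^ 2 + ‖u x‖ₑ ^ 6) := by
        refine lintegral_mono fun x => ?_
        rcases le_total ‖u x‖ₑ 1 with h | h
        · exact (pow_le_pow_right_of_le_one' h (by norm_num)).trans le_self_add
        · exact (pow_le_pow_right₀ h (by norm_num)).trans le_add_self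
    _ = (∫⁻ x, ‖u x‖ₑ ^ 2) + ∫⁻ x, ‖u x‖ₑ ^ 6 := lintegral_add_left (hum.pow_const 2) _
    _ ≤ ENNReal.ofReal (K ^ 2) + 4096 * (ENNReal.ofReal (K ^ 2)) ^ 3 := by
        gcongr
        exact h6.trans (by gcongr)
    _ = _ := by
        rw [ENNReal.ofReal_add (by positivity) (by positivity),
          ENNReal.ofReal_mul (by norm_num), ← ENNReal.ofReal_pow (by positivity), ← pow_mul]
        norm_num

/-- The properties of the rescaled scattering function `w = 1 - f` used for the kernel bounds. -/
structure IsScatteringTail (ℓ b C₀ : ℝ) (N : ℕ) (w : R3 → ℝ) : Prop where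
  nonneg_le_one : ∀ x, 0 ≤ w x ∧ w x ≤ 1
  support_subset : Function.support w ⊆ closedBall (0 : R3) (N * ℓ)
  le_div_norm : ∀ x : R3, x ≠ 0 → w x ≤ C₀ * b / ‖x‖
  differentiableAt : ∀ x : R3, x ≠ 0 → DifferentiableAt ℝ w x
  eLpNorm_fderiv_le : eLpNorm (fun x => fderiv ℝ w x) 2 volume ≤ ENNReal.ofReal C₀

namespace IsScatteringTail

variable {ℓ b C₀ : ℝ} {N : ℕ} {w : R3 → ℝ}

lemma comp_neg (hw : IsScatteringTail ℓ b C₀ N w) :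
    IsScatteringTail ℓ b C₀ N fun x => w (-x) where
  nonneg_le_one x := hw.nonneg_le_one _
  support_subset x hx := by simpa using hw.support_subset (a := -x) hx
  le_div_norm x hx := by simpa using hw.le_div_norm (-x) (neg_ne_zero.2 hx)
  differentiableAt x hx :=
    (hw.differentiableAt (-x) (neg_ne_zero.2 hx)).comp x differentiableAt_id.neg
  eLpNorm_fderiv_le := by
    have h : ∀ x, ‖fderiv ℝ (fun x => w (-x)) x‖ₑ = ‖fderiv ℝ w (-x)‖ₑ := fun x => by
      have := fderiv_comp_smul (f := w) (x := x) (-1 : ℝ)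
      simp only [neg_smul, one_smul] at this
      rw [this, enorm_neg]
    calc _ = eLpNorm ((fun x => fderiv ℝ w x) ∘ fun x : R3 => -x) 2 volume :=
          eLpNorm_congr_enorm_ae (.of_forall h)
      _ = eLpNorm (fun x => fderiv ℝ w x) 2 volume :=
          eLpNorm_comp_measurePreserving (measurable_fderiv ℝ w).aestronglyMeasurable
            (Measure.measurePreserving_neg _)
      _ ≤ _ := hw.eLpNorm_fderiv_le

lemma measurable (hw : IsScatteringTail ℓ b C₀ N w) : Measurable w :=
  measurable_of_continuousOn_compl_singleton 0 fun x hx =>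
    (hw.differentiableAt x hx).continuousAt.continuousWithinAt

/-- The rescaled tail `N w(N·)` is square integrable, uniformly in `N`. -/
lemma lintegral_sq_le (hℓ : 0 < ℓ) (hw : IsScatteringTail ℓ b C₀ N w) :
    ∫⁻ z, ‖(N : ℝ) * w ((N : ℝ) • z)‖ₑ ^ 2 ≤
      ∫⁻ z in ball (0 : R3) (2 * ℓ), ‖(C₀ * b) ^ 2 * (‖z‖ ^ 2)⁻¹‖ₑ := by
  rw [← lintegral_indicator measurableSet_ball]
  refine lintegral_mono_ae ?_
  filter_upwards [Measure.ae_ne volume (0 : R3)] with z hz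
  by_cases hN : N = 0
  · simp [hN]
  have hN' : (0 : ℝ) < N := by positivity
  have hz' : 0 < ‖z‖ := norm_pos_iff.2 hz
  by_cases hzw : w ((N : ℝ) • z) = 0
  · simp [hzw]
  have hzl : ‖z‖ ≤ ℓ := by
    have := hw.support_subset hzw
    rw [mem_closedBall_zero_iff, norm_smul, Real.norm_eq_abs, Nat.abs_cast] at this
    exact le_of_mul_le_mul_left this hN'
  rw [Set.indicator_of_mem (by rw [mem_ball_zero_iff]; linarith), ← enorm_pow,
    Real.enorm_of_nonneg (by positivity), Real.enorm_of_nonneg (by positivity)]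
  refine ENNReal.ofReal_le_ofReal ?_
  have h1 := hw.le_div_norm ((N : ℝ) • z) (smul_ne_zero hN'.ne' hz)
  have h0 := (hw.nonneg_le_one ((N : ℝ) • z)).1
  rw [norm_smul, Real.norm_eq_abs, Nat.abs_cast] at h1
  rw [← inv_pow, ← mul_pow]
  refine pow_le_pow_left₀ (by positivity) ?_ 2
  calc (N : ℝ) * w ((N : ℝ) • z) ≤ N * (C₀ * b / (N * ‖z‖)) := by gcongr
    _ = C₀ * b * ‖z‖⁻¹ := by field_simp

/-- Scaling of the Dirichlet energy of the tail. -/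
lemma lintegral_fderiv_sq_le (hw : IsScatteringTail ℓ b C₀ N w) :
    ∫⁻ z, ((N : ℝ≥0∞) ^ 2 * ‖fderiv ℝ w ((N : ℝ) • z)‖ₑ) ^ 2 ≤ N * ENNReal.ofReal C₀ ^ 2 := by
  by_cases hN : N = 0
  · simp [hN]
  have hN' : (N : ℝ) ≠ 0 := by positivity
  have hN0 : (N : ℝ≥0∞) ≠ 0 := by simpa using hN
  have hm : Measurable fun x => ‖fderiv ℝ w x‖ₑ ^ 2 := (measurable_fderiv ℝ w).enorm.pow_const 2
  have hscale : ∫⁻ z, ‖fderiv ℝ w ((N : ℝ) • z)‖ₑ ^ 2 =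
      ((N : ℝ≥0∞) ^ 3)⁻¹ * ∫⁻ z, ‖fderiv ℝ w z‖ₑ ^ 2 := by
    rw [← lintegral_map hm (measurable_const_smul (N : ℝ)),
      Measure.map_addHaar_smul volume hN', lintegral_smul_measure, smul_eq_mul]
    congr 1
    rw [abs_of_nonneg (by positivity), ENNReal.ofReal_inv_of_pos (by positivity),
      ENNReal.ofReal_pow (by positivity)]
    simp
  simp_rw [mul_pow]
  rw [lintegral_const_mul' _ _ (by finiteness), hscale,
    lintegral_enorm_sq_eq_eLpNorm_sq, ← mul_assoc]
  gcongr
  · refine le_of_eq ?_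
    rw [← pow_mul, show 2 * 2 = 1 + 3 from rfl, pow_add, mul_assoc,
      ENNReal.mul_inv_cancel (pow_ne_zero _ hN0) (ENNReal.pow_ne_top (ENNReal.natCast_ne_top N)),
      mul_one, pow_one]
  · exact hw.eLpNorm_fderiv_le

end IsScatteringTail

lemma lintegral_ball_inv_norm_sq_ne_top (c r : ℝ) :
    ∫⁻ z in ball (0 : R3) r, ‖c * (‖z‖ ^ 2)⁻¹‖ₑ ≠ ⊤ := by
  have h : IntegrableOn (fun z : R3 => c * (‖z‖ ^ 2)⁻¹) (ball 0 r) := by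
    rw [integrableOn_fun_norm_addHaar volume (f := fun t => c * (t ^ 2)⁻¹)]
    have hc : IntegrableOn (fun _ : ℝ => c) (Set.Ioo 0 r) := by simp
    refine hc.congr_fun (fun t ht => ?_) measurableSet_Ioo
    have : t ≠ 0 := ht.1.ne'
    simp
    field_simp
  exact h.2.ne

section Convolution

variable {E : Type*} [NormedAddCommGroup E] [MeasurableSpace E] [BorelSpace E]
  [SecondCountableTopology E] {μ : Measure E} [SFinite μ] [μ.IsAddLeftInvariant]
  [μ.IsNegInvariant] {κ f : E → ℝ≥0∞}

lemma lintegral_prod_sub_mul_fst (hκ : Measurable κ) (hf : Measurable f) :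
    ∫⁻ z : E × E, κ (z.1 - z.2) * f z.1 ∂μ.prod μ = (∫⁻ z, κ z ∂μ) * ∫⁻ x, f x ∂μ := by
  rw [lintegral_prod _ (by fun_prop), ← lintegral_const_mul _ hf]
  refine lintegral_congr fun x => ?_
  simp only
  rw [lintegral_mul_const _ (by fun_prop), lintegral_sub_left_eq_self κ x]

lemma lintegral_prod_sub_mul_snd (hκ : Measurable κ) (hf : Measurable f) :
    ∫⁻ z : E × E, κ (z.1 - z.2) * f z.2 ∂μ.prod μ = (∫⁻ z, κ z ∂μ) * ∫⁻ x, f x ∂μ := by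
  rw [← lintegral_prod_swap]
  simp only [Prod.fst_swap, Prod.snd_swap]
  have := lintegral_prod_sub_mul_fst (μ := μ) (hκ.comp measurable_neg) hf
  simp only [comp_def, neg_sub] at this
  rw [this, lintegral_neg_eq_self κ]

end Convolution

lemma ENNReal.mul_le_sq_add_sq (s t : ℝ≥0∞) : s * t ≤ s ^ 2 + t ^ 2 := by
  rcases le_total s t with h | h
  · calc s * t ≤ t * t := by gcongr
      _ = t ^ 2 := (sq t).symm
      _ ≤ _ := le_add_self
  · calc s * t ≤ s * s := by gcongr
      _ = s ^ 2 := (sq s).symm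
      _ ≤ _ := le_self_add

lemma ENNReal.add_sq_le_three_mul (s t : ℝ≥0∞) : (s + t) ^ 2 ≤ 3 * (s ^ 2 + t ^ 2) := by
  calc (s + t) ^ 2 = s ^ 2 + t ^ 2 + 2 * (s * t) := by ring
    _ ≤ s ^ 2 + t ^ 2 + 2 * (s ^ 2 + t ^ 2) := by
      gcongr
      exact ENNReal.mul_le_sq_add_sq s t
    _ = _ := by ring

section PairKernel

variable {N : ℕ} {w : R3 → ℝ} {u v : R3 → ℂ}

lemma enorm_pairKernel (x y : R3) :
    ‖pairKernel N w u v x y‖ₑ = ‖(N : ℝ) * w ((N : ℝ) • (x - y))‖ₑ * ‖u x‖ₑ * ‖v y‖ₑ := by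
  simp only [pairKernel, enorm_mul, enorm_neg]
  congr 3
  · rw [← ofReal_norm, ← ofReal_norm]; simp
  · rw [← ofReal_norm, ← ofReal_norm]; simp

/-- Exchanging the variables amounts to reflecting `w` and exchanging `u` and `v`. -/
lemma pairKernel_comp_neg (x y : R3) :
    pairKernel N (fun z => w (-z)) v u y x = pairKernel N w u v x y := by
  simp only [pairKernel, ← smul_neg, neg_sub]
  ring

/-- Product rule for the kernel away from the singularity of `w`. -/
lemma enorm_fderiv_pairKernel_le {x y : R3} (hu : Differentiable ℝ u)
    (hw : DifferentiableAt ℝ w ((N : ℝ) • (x - y))) :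
    ‖fderiv ℝ (fun x => pairKernel N w u v x y) x‖ₑ ≤
      (N : ℝ≥0∞) ^ 2 * ‖fderiv ℝ w ((N : ℝ) • (x - y))‖ₑ * ‖u x‖ₑ * ‖v y‖ₑ +
        ‖(N : ℝ) * w ((N : ℝ) • (x - y))‖ₑ * ‖fderiv ℝ u x‖ₑ * ‖v y‖ₑ := by
  have hφ : HasFDerivAt (fun x => w ((N : ℝ) • (x - y)))
      ((fderiv ℝ w ((N : ℝ) • (x - y))).comp ((N : ℝ) • ContinuousLinearMap.id ℝ R3)) x :=
    hw.hasFDerivAt.comp x (((hasFDerivAt_id x).sub_const y).const_smul (N : ℝ))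
  have hk : HasFDerivAt (fun x => pairKernel N w u v x y) _ x :=
    ((hφ.smul (hu x).hasFDerivAt).const_smul (-(N : ℂ) * v y)).congr_of_eventuallyEq
      (.of_forall fun z => by
        simp only [pairKernel, Pi.smul_apply, Pi.smul_apply', Complex.real_smul, smul_eq_mul]
        ring)
  rw [hk.fderiv, ContinuousLinearMap.comp_smul, ContinuousLinearMap.comp_id, enorm_smul]
  refine (mul_le_mul' le_rfl (enorm_add_le (_ : R3 →L[ℝ] ℂ) _)).trans_eq ?_
  have hN : ‖(N : ℝ)‖ₑ = N := by rw [Real.enorm_of_nonneg (by positivity)]; simp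
  have hNc : ‖(N : ℂ)‖ₑ = N := by rw [← ofReal_norm]; simp
  have hsm : ∀ (L : R3 →L[ℝ] ℝ) (c : ℂ), ‖L.smulRight c‖ₑ = ‖L‖ₑ * ‖c‖ₑ := fun L c => by
    rw [← ofReal_norm, ContinuousLinearMap.norm_smulRight_apply,
      ENNReal.ofReal_mul (norm_nonneg _), ofReal_norm, ofReal_norm]
  rw [hsm]
  simp only [enorm_smul, enorm_mul, enorm_neg, hN, hNc]
  ring

variable {T a S k m : ℝ≥0∞}

/-- Hilbert–Schmidt bounds on the kernel through `L^∞` and through `L⁴`. -/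
lemma lintegral_pairKernel_sq_le (hw : Measurable w) (hu : Measurable u) (hv : Measurable v)
    (ha : ∫⁻ z, ‖(N : ℝ) * w ((N : ℝ) • z)‖ₑ ^ 2 ≤ a)
    (hv2 : ∫⁻ x, ‖v x‖ₑ ^ 2 ≤ k)
    (hu4 : ∫⁻ x, ‖u x‖ₑ ^ 4 ≤ S) (hv4 : ∫⁻ x, ‖v x‖ₑ ^ 4 ≤ S) (hm : ∀ x, ‖u x‖ₑ ≤ m) :
    ∫⁻ z : R3 × R3, ‖pairKernel N w u v z.1 z.2‖ₑ ^ 2 ≤ a * k * m ^ 2 ∧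
    ∫⁻ z : R3 × R3, ‖pairKernel N w u v z.1 z.2‖ₑ ^ 2 ≤ a * (S + S) := by
  set κ : R3 → ℝ≥0∞ := fun z => ‖(N : ℝ) * w ((N : ℝ) • z)‖ₑ ^ 2 with hκ
  have hκm : Measurable κ := by fun_prop
  have hkey : ∀ z : R3 × R3, ‖pairKernel N w u v z.1 z.2‖ₑ ^ 2 =
      κ (z.1 - z.2) * (‖u z.1‖ₑ ^ 2 * ‖v z.2‖ₑ ^ 2) := fun z => by
    rw [enorm_pairKernel]; ring
  simp_rw [hkey, Measure.volume_eq_prod]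
  constructor
  · calc _ ≤ ∫⁻ z : R3 × R3, (κ (z.1 - z.2) * ‖v z.2‖ₑ ^ 2) * m ^ 2 ∂volume.prod volume := by
          refine lintegral_mono fun z => ?_
          rw [mul_assoc, mul_comm (‖v z.2‖ₑ ^ 2)]
          gcongr
          exact hm _
      _ = (∫⁻ z, κ z) * (∫⁻ x, ‖v x‖ₑ ^ 2) * m ^ 2 := by
          rw [lintegral_mul_const _ (by fun_prop),
            lintegral_prod_sub_mul_snd (f := fun x => ‖v x‖ₑ ^ 2) hκm (by fun_prop)]
      _ ≤ _ := by gcongr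
  · calc _ ≤ ∫⁻ z : R3 × R3, (κ (z.1 - z.2) * ‖u z.1‖ₑ ^ 4 + κ (z.1 - z.2) * ‖v z.2‖ₑ ^ 4)
            ∂volume.prod volume := by
          refine lintegral_mono fun z => ?_
          rw [← mul_add]
          gcongr
          refine (ENNReal.mul_le_sq_add_sq _ _).trans_eq (by ring)
      _ = (∫⁻ z, κ z) * (∫⁻ x, ‖u x‖ₑ ^ 4) + (∫⁻ z, κ z) * (∫⁻ x, ‖v x‖ₑ ^ 4) := by
          rw [lintegral_add_left (by fun_prop),
            lintegral_prod_sub_mul_fst (f := fun x => ‖u x‖ₑ ^ 4) hκm (by fun_prop),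
            lintegral_prod_sub_mul_snd (f := fun x => ‖v x‖ₑ ^ 4) hκm (by fun_prop)]
      _ ≤ _ := by rw [mul_add]; gcongr

/-- Hilbert–Schmidt bounds on the gradient of the kernel through `L^∞` and through `L⁴`. -/
lemma lintegral_fderiv_pairKernel_sq_le (hN : N ≠ 0) (hw : Measurable w)
    (hwd : ∀ x, x ≠ 0 → DifferentiableAt ℝ w x) (hw1 : ∀ x, 0 ≤ w x ∧ w x ≤ 1)
    (hu : Differentiable ℝ u) (hv : Measurable v)
    (hT : ∫⁻ z, ((N : ℝ≥0∞) ^ 2 * ‖fderiv ℝ w ((N : ℝ) • z)‖ₑ) ^ 2 ≤ T)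
    (ha : ∫⁻ z, ‖(N : ℝ) * w ((N : ℝ) • z)‖ₑ ^ 2 ≤ a)
    (hdu2 : ∫⁻ x, ‖fderiv ℝ u x‖ₑ ^ 2 ≤ k) (hv2 : ∫⁻ x, ‖v x‖ₑ ^ 2 ≤ k)
    (hu4 : ∫⁻ x, ‖u x‖ₑ ^ 4 ≤ S) (hv4 : ∫⁻ x, ‖v x‖ₑ ^ 4 ≤ S)
    (hmu : ∀ x, ‖u x‖ₑ ≤ m) (hmv : ∀ x, ‖v x‖ₑ ≤ m) :
    ∫⁻ z : R3 × R3, ‖fderiv ℝ (fun x => pairKernel N w u v x z.2) z.1‖ₑ ^ 2 ≤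
      3 * (T * k + a * k) * m ^ 2 ∧
    ∫⁻ z : R3 × R3, ‖fderiv ℝ (fun x => pairKernel N w u v x z.2) z.1‖ₑ ^ 2 ≤
      3 * (T * (S + S) + N * (a * k + k * S)) := by
  have hum : Measurable u := hu.continuous.measurable
  have hdum : Measurable (fderiv ℝ u) := measurable_fderiv ℝ u
  have hdwm : Measurable (fderiv ℝ w) := measurable_fderiv ℝ w
  set κ : R3 → ℝ≥0∞ := fun z => ‖(N : ℝ) * w ((N : ℝ) • z)‖ₑ ^ 2 with hκ
  set τ : R3 → ℝ≥0∞ := fun z => ((N : ℝ≥0∞) ^ 2 * ‖fderiv ℝ w ((N : ℝ) • z)‖ₑ) ^ 2 with hτ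
  have hκm : Measurable κ := by fun_prop
  have hτm : Measurable τ := by fun_prop
  have hdiag : ∀ᵐ z : R3 × R3, z.1 ≠ z.2 := by
    have h : MeasurableSet {z : R3 × R3 | z.1 ≠ z.2} :=
      (measurableSet_eq_fun measurable_fst measurable_snd).compl
    rw [Measure.volume_eq_prod, Measure.ae_prod_iff_ae_ae h]
    exact .of_forall fun x => (Measure.ae_ne volume x).mono fun y hy => hy.symm
  have hsplit : ∫⁻ z : R3 × R3, ‖fderiv ℝ (fun x => pairKernel N w u v x z.2) z.1‖ₑ ^ 2 ≤
      3 * ((∫⁻ z : R3 × R3, τ (z.1 - z.2) * (‖u z.1‖ₑ ^ 2 * ‖v z.2‖ₑ ^ 2)) +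
        ∫⁻ z : R3 × R3, κ (z.1 - z.2) * (‖fderiv ℝ u z.1‖ₑ ^ 2 * ‖v z.2‖ₑ ^ 2)) := by
    rw [← lintegral_add_left (by fun_prop), ← lintegral_const_mul _ (by fun_prop)]
    refine lintegral_mono_ae (hdiag.mono fun z hz => ?_)
    refine (pow_le_pow_left' (enorm_fderiv_pairKernel_le hu (hwd _
      (smul_ne_zero (by positivity) (sub_ne_zero.2 hz)))) 2).trans ?_
    refine (ENNReal.add_sq_le_three_mul _ _).trans_eq ?_
    simp only [hκ, hτ]
    ring
  rw [Measure.volume_eq_prod] at hsplit ⊢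
  constructor
  · refine hsplit.trans ?_
    rw [mul_assoc, add_mul]
    gcongr
    · calc _ ≤ ∫⁻ z : R3 × R3, (τ (z.1 - z.2) * ‖v z.2‖ₑ ^ 2) * m ^ 2 ∂volume.prod volume := by
            refine lintegral_mono fun z => ?_
            rw [mul_assoc, mul_comm (‖v z.2‖ₑ ^ 2)]
            gcongr
            exact hmu _
        _ = (∫⁻ z, τ z) * (∫⁻ x, ‖v x‖ₑ ^ 2) * m ^ 2 := by
            rw [lintegral_mul_const _ (by fun_prop),
              lintegral_prod_sub_mul_snd (f := fun x => ‖v x‖ₑ ^ 2) hτm (by fun_prop)]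
        _ ≤ _ := by gcongr
    · calc _ ≤ ∫⁻ z : R3 × R3, (κ (z.1 - z.2) * ‖fderiv ℝ u z.1‖ₑ ^ 2) * m ^ 2
              ∂volume.prod volume := by
            refine lintegral_mono fun z => ?_
            rw [mul_assoc]
            gcongr
            exact hmv _
        _ = (∫⁻ z, κ z) * (∫⁻ x, ‖fderiv ℝ u x‖ₑ ^ 2) * m ^ 2 := by
            rw [lintegral_mul_const _ (by fun_prop),
              lintegral_prod_sub_mul_fst (f := fun x => ‖fderiv ℝ u x‖ₑ ^ 2) hκm (by fun_prop)]
        _ ≤ _ := by gcongr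
  · refine hsplit.trans ?_
    gcongr
    · calc _ ≤ ∫⁻ z : R3 × R3, (τ (z.1 - z.2) * ‖u z.1‖ₑ ^ 4 + τ (z.1 - z.2) * ‖v z.2‖ₑ ^ 4)
              ∂volume.prod volume := by
            refine lintegral_mono fun z => ?_
            rw [← mul_add]
            gcongr
            refine (ENNReal.mul_le_sq_add_sq _ _).trans_eq (by ring)
        _ = (∫⁻ z, τ z) * (∫⁻ x, ‖u x‖ₑ ^ 4) + (∫⁻ z, τ z) * (∫⁻ x, ‖v x‖ₑ ^ 4) := by
            rw [lintegral_add_left (by fun_prop),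
              lintegral_prod_sub_mul_fst (f := fun x => ‖u x‖ₑ ^ 4) hτm (by fun_prop),
              lintegral_prod_sub_mul_snd (f := fun x => ‖v x‖ₑ ^ 4) hτm (by fun_prop)]
        _ ≤ _ := by rw [mul_add]; gcongr
    · calc _ ≤ ∫⁻ z : R3 × R3, N * (κ (z.1 - z.2) * ‖fderiv ℝ u z.1‖ₑ ^ 2 +
              ‖fderiv ℝ u z.1‖ₑ ^ 2 * ‖v z.2‖ₑ ^ 4) ∂volume.prod volume := by
            refine lintegral_mono fun z => ?_
            set s := ‖(N : ℝ) * w ((N : ℝ) • (z.1 - z.2))‖ₑ with hs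
            have hsN : s ≤ N := by
              have h1 := hw1 ((N : ℝ) • (z.1 - z.2))
              rw [hs, Real.enorm_of_nonneg (mul_nonneg (Nat.cast_nonneg _) h1.1),
                ← ENNReal.ofReal_natCast]
              exact ENNReal.ofReal_le_ofReal (mul_le_of_le_one_right (Nat.cast_nonneg _) h1.2)
            calc s ^ 2 * (‖fderiv ℝ u z.1‖ₑ ^ 2 * ‖v z.2‖ₑ ^ 2)
                = s * (s * ‖v z.2‖ₑ ^ 2) * ‖fderiv ℝ u z.1‖ₑ ^ 2 := by ring
              _ ≤ N * (s ^ 2 + (‖v z.2‖ₑ ^ 2) ^ 2) * ‖fderiv ℝ u z.1‖ₑ ^ 2 := by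
                gcongr
                exact ENNReal.mul_le_sq_add_sq _ _
              _ = N * (s ^ 2 * ‖fderiv ℝ u z.1‖ₑ ^ 2 +
                  ‖fderiv ℝ u z.1‖ₑ ^ 2 * ‖v z.2‖ₑ ^ 4) := by ring
        _ = N * ((∫⁻ z, κ z) * (∫⁻ x, ‖fderiv ℝ u x‖ₑ ^ 2) +
              (∫⁻ x, ‖fderiv ℝ u x‖ₑ ^ 2) * ∫⁻ x, ‖v x‖ₑ ^ 4) := by
            rw [lintegral_const_mul _ (by fun_prop), lintegral_add_left (by fun_prop),
              lintegral_prod_sub_mul_fst (f := fun x => ‖fderiv ℝ u x‖ₑ ^ 2) hκm (by fun_prop),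
              lintegral_prod_mul (f := fun x => ‖fderiv ℝ u x‖ₑ ^ 2)
                (g := fun x => ‖v x‖ₑ ^ 4) (by fun_prop) (by fun_prop)]
        _ ≤ _ := by gcongr

end PairKernel

lemma eLpNorm_two_le_of_lintegral_sq_le {α E : Type*} [MeasurableSpace α] {μ : Measure α}
    [NormedAddCommGroup E] {f : α → E} {c : ℝ≥0∞} (h : ∫⁻ x, ‖f x‖ₑ ^ 2 ∂μ ≤ c ^ 2) :
    eLpNorm f 2 μ ≤ c := by
  rw [lintegral_enorm_sq_eq_eLpNorm_sq] at h
  exact (ENNReal.pow_le_pow_left_iff two_ne_zero).1 h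

lemma le_mul_min_sq {I P Q B c m : ℝ≥0∞} (hP : P ≤ B * c) (hQ : Q ≤ B * c)
    (h : I ≤ P * m ^ 2 ∧ I ≤ Q) : I ≤ B * c * min m 1 ^ 2 := by
  rcases min_choice m 1 with hmin | hmin <;> rw [hmin]
  · exact h.1.trans (by gcongr)
  · simpa using h.2.trans hQ

/-- **Hilbert–Schmidt bounds on the pair-excitation kernel.** -/
theorem pair_kernel_HS_bounds (ℓ b C₀ K : ℝ)
    (hℓ : 0 < ℓ) (hb : 0 < b) (hC₀ : 0 < C₀) (hK : 0 < K) :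
    ∃ C > (0 : ℝ),
    ∀ (N : ℕ) (w : R3 → ℝ) (u v : R3 → ℂ) (Mu Mv : ℝ),
      (∀ x, 0 ≤ w x ∧ w x ≤ 1) →
      Function.support w ⊆ closedBall (0 : R3) (N * ℓ) →
      (∀ x : R3, x ≠ 0 → w x ≤ C₀ * b / ‖x‖) →
      (∀ x : R3, x ≠ 0 → DifferentiableAt ℝ w x ∧ ‖fderiv ℝ w x‖ ≤ C₀ * b / ‖x‖ ^ 2) →
      eLpNorm (fun x => fderiv ℝ w x) 2 volume ≤ ENNReal.ofReal C₀ →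
      Differentiable ℝ u → Differentiable ℝ v →
      -- `u, v ∈ H¹` with `H¹` norms at most `K`
      W1Norm 2 u ≤ ENNReal.ofReal K → W1Norm 2 v ≤ ENNReal.ofReal K →
      -- `u, v ∈ L^∞` with `‖u‖_{L^∞} ≤ Mu`, `‖v‖_{L^∞} ≤ Mv`
      (∀ x, ‖u x‖ ≤ Mu) → (∀ x, ‖v x‖ ≤ Mv) →
      -- conclusions
      (eLpNorm (fun z : R3 × R3 => pairKernel N w u v z.1 z.2) 2 volume
          ≤ ENNReal.ofReal (C * min (max Mu Mv) 1) ∧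
        eLpNorm (fun z : R3 × R3 =>
            fderiv ℝ (fun x => pairKernel N w u v x z.2) z.1) 2 volume
          ≤ ENNReal.ofReal (C * Real.sqrt N * min (Mu + Mv) 1) ∧
        eLpNorm (fun z : R3 × R3 =>
            fderiv ℝ (fun y => pairKernel N w u v z.1 y) z.2) 2 volume
          ≤ ENNReal.ofReal (C * Real.sqrt N * min (Mu + Mv) 1)) := by
  set A := ∫⁻ z in ball (0 : R3) (2 * ℓ), ‖(C₀ * b) ^ 2 * (‖z‖ ^ 2)⁻¹‖ₑ with hA
  set c₀ := ENNReal.ofReal C₀ with hc₀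
  set k := ENNReal.ofReal K ^ 2 with hk
  set S := ENNReal.ofReal (K ^ 2 + 4096 * K ^ 6) with hS
  set B : ℝ≥0∞ := 1 + (A * k + A * (S + S)) +
    (3 * (c₀ ^ 2 * k + A * k) + 3 * (c₀ ^ 2 * (S + S) + (A * k + k * S))) with hB
  have hAt : A ≠ ⊤ := lintegral_ball_inv_norm_sq_ne_top _ _
  have hBt : B ≠ ⊤ := by finiteness
  have hB1 : 1 ≤ B := le_add_right le_self_add
  have hBr : 1 ≤ B.toReal := by
    simpa using (ENNReal.toReal_le_toReal ENNReal.one_ne_top hBt).2 hB1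
  have hCsq : ENNReal.ofReal √B.toReal ^ 2 = B := by
    rw [← ENNReal.ofReal_pow (by positivity), Real.sq_sqrt (by positivity),
      ENNReal.ofReal_toReal hBt]
  refine ⟨√B.toReal, by positivity, ?_⟩
  intro N w u v Mu Mv hw1 hws hwd hwg hwL hu hv huK hvK hMu hMv
  by_cases hN : N = 0
  · refine ⟨eLpNorm_two_le_of_lintegral_sq_le ?_, eLpNorm_two_le_of_lintegral_sq_le ?_,
      eLpNorm_two_le_of_lintegral_sq_le ?_⟩ <;> simp [pairKernel, hN]
  have hN1 : (1 : ℝ≥0∞) ≤ N := by exact_mod_cast Nat.one_le_iff_ne_zero.2 hN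
  have hw : IsScatteringTail ℓ b C₀ N w := ⟨hw1, hws, hwd, fun x hx => (hwg x hx).1, hwL⟩
  have hMu0 : 0 ≤ Mu := (norm_nonneg _).trans (hMu 0)
  have hMv0 : 0 ≤ Mv := (norm_nonneg _).trans (hMv 0)
  have hsq : ∀ f : R3 → ℂ, W1Norm 2 f ≤ ENNReal.ofReal K →
      ∫⁻ x, ‖f x‖ₑ ^ 2 ≤ k ∧ ∫⁻ x, ‖fderiv ℝ f x‖ₑ ^ 2 ≤ k := fun f hf => by
    rw [lintegral_enorm_sq_eq_eLpNorm_sq, lintegral_enorm_sq_eq_eLpNorm_sq]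
    exact ⟨pow_le_pow_left' (le_self_add.trans hf) 2, pow_le_pow_left' (le_add_self.trans hf) 2⟩
  have hu4 := lintegral_enorm_pow_four_le hu hK.le hMu huK
  have hv4 := lintegral_enorm_pow_four_le hv hK.le hMv hvK
  have henorm : ∀ {f : R3 → ℂ} {M M' : ℝ}, (∀ x, ‖f x‖ ≤ M) → M ≤ M' →
      ∀ x, ‖f x‖ₑ ≤ ENNReal.ofReal M' := fun hf hM x => by
    rw [← ofReal_norm]
    exact ENNReal.ofReal_le_ofReal ((hf x).trans hM)
  have hgrad : ∀ {w : R3 → ℝ} {u v : R3 → ℂ}, IsScatteringTail ℓ b C₀ N w →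
      Differentiable ℝ u → Differentiable ℝ v →
      W1Norm 2 u ≤ ENNReal.ofReal K → W1Norm 2 v ≤ ENNReal.ofReal K →
      ∫⁻ x, ‖u x‖ₑ ^ 4 ≤ S → ∫⁻ x, ‖v x‖ₑ ^ 4 ≤ S →
      (∀ x, ‖u x‖ₑ ≤ ENNReal.ofReal (Mu + Mv)) → (∀ x, ‖v x‖ₑ ≤ ENNReal.ofReal (Mu + Mv)) →
      ∫⁻ z : R3 × R3, ‖fderiv ℝ (fun x => pairKernel N w u v x z.2) z.1‖ₑ ^ 2 ≤
        ENNReal.ofReal (√B.toReal * √N * min (Mu + Mv) 1) ^ 2 := by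
    intro w u v hw hu hv huK hvK hu4 hv4 hMu hMv
    have h := lintegral_fderiv_pairKernel_sq_le hN hw.measurable hw.differentiableAt
      hw.nonneg_le_one hu hv.continuous.measurable hw.lintegral_fderiv_sq_le
      (hw.lintegral_sq_le hℓ) (hsq u huK).2 (hsq v hvK).1 hu4 hv4 hMu hMv
    have hP : 3 * (N * c₀ ^ 2 * k + A * k) ≤ B * N := by
      calc 3 * (N * c₀ ^ 2 * k + A * k) ≤ 3 * (N * c₀ ^ 2 * k + A * k * N) := by
            exact mul_le_mul' le_rfl (add_le_add le_rfl (le_mul_of_one_le_right' hN1))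
        _ = 3 * (c₀ ^ 2 * k + A * k) * N := by ring
        _ ≤ B * N := by
            gcongr
            exact le_self_add.trans le_add_self
    have hQ : 3 * (N * c₀ ^ 2 * (S + S) + N * (A * k + k * S)) ≤ B * N := by
      calc _ = 3 * (c₀ ^ 2 * (S + S) + (A * k + k * S)) * N := by ring
        _ ≤ B * N := by
            gcongr
            exact le_add_self.trans le_add_self
    refine (le_mul_min_sq hP hQ h).trans_eq ?_
    rw [ENNReal.ofReal_mul (by positivity), ENNReal.ofReal_mul (by positivity), mul_pow,
      mul_pow, hCsq, ← ENNReal.ofReal_pow (Real.sqrt_nonneg _), Real.sq_sqrt (by positivity),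
      ENNReal.ofReal_natCast, ENNReal.ofReal_min, ENNReal.ofReal_one]
  have hMul : Mu ≤ Mu + Mv := by linarith
  have hMvl : Mv ≤ Mu + Mv := by linarith
  refine ⟨eLpNorm_two_le_of_lintegral_sq_le ?_, eLpNorm_two_le_of_lintegral_sq_le ?_,
    eLpNorm_two_le_of_lintegral_sq_le ?_⟩
  · have h := lintegral_pairKernel_sq_le hw.measurable hu.continuous.measurable
      hv.continuous.measurable (hw.lintegral_sq_le hℓ) (hsq v hvK).1 hu4 hv4
      (henorm hMu (le_max_left Mu Mv))
    have hP : A * k ≤ B * 1 := by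
      rw [mul_one]
      exact le_self_add.trans (le_add_self.trans le_self_add)
    have hQ : A * (S + S) ≤ B * 1 := by
      rw [mul_one]
      exact le_add_self.trans (le_add_self.trans le_self_add)
    refine (le_mul_min_sq hP hQ h).trans_eq ?_
    rw [ENNReal.ofReal_mul (by positivity), mul_pow, hCsq, ENNReal.ofReal_min,
      ENNReal.ofReal_one, mul_one]
  · exact hgrad hw hu hv huK hvK hu4 hv4 (henorm hMu hMul) (henorm hMv hMvl)
  · rw [Measure.volume_eq_prod, ← lintegral_prod_swap]
    simp only [Prod.fst_swap, Prod.snd_swap]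
    simp_rw [← pairKernel_comp_neg (N := N) (w := w) (u := u) (v := v)]
    exact hgrad hw.comp_neg hv hu hvK huK hv4 hu4 (henorm hMv hMvl) (henorm hMu hMul)
end
end
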